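/- Let K be a field, n ≥ 2, A = K[x₁,…,xₙ], and let e'_{ij} (1 ≤ i,j ≤ n) be a subbase of End A. Then the following are equivalent: (i) ('external' base property) there exist z₁,…,zₙ ∈ A forming a base of A (i.e., the K-algebra endomorphism x_i ↦ z_i is an automorphism of A) such that image(e'_{ii}) ⊆ K[z_i] for every i, where K[z_i] = Algebra.adjoin K {z_i}; (ii) ('internal' base property) for every family α₁,…,αₙ of K-algebra endomorphisms of A and every subbase f'_{ij} (1 ≤ i,j ≤ n) of End A there exist K-algebra endomorphisms φ, ψ of A such that α_i ∘ f'_{ii} = ψ ∘ e'_{ii} ∘ φ for all i. -/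

import Mathlib

open MvPolynomial

/-- The transcendence degree of an algebra `A` over `K`: the supremum of cardinalities of
algebraically independent subsets (mirrors Mathlib's `Algebra.trdeg`). -/
noncomputable def algTrdeg (K A : Type*) [CommRing K] [CommRing A] [Algebra K A] : Cardinal :=
  ⨆ ι : { s : Set A // AlgebraicIndependent K ((↑) : s → A) }, Cardinal.mk ι.1


/-- The `K`-algebra endomorphism `Ô` of `K[x₁,…,xₙ]` sending every variable to `0`. -/
noncomputable def zeroEnd (K : Type) [Field K] (n : ℕ) :
    MvPolynomial (Fin n) K →ₐ[K] MvPolynomial (Fin n) K :=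
  MvPolynomial.aeval fun _ : Fin n => (0 : MvPolynomial (Fin n) K)

section IdealOfVars

variable {K : Type*} [Field K] {n : ℕ}

theorem mem_idealOfVars_iff_constantCoeff_eq_zero {a : MvPolynomial (Fin n) K} :
    a ∈ idealOfVars (Fin n) K ↔ constantCoeff a = 0 := by
  rw [← pow_one (idealOfVars (Fin n) K), mem_pow_idealOfVars_iff', constantCoeff_eq]
  constructor
  · intro h
    exact h 0 (by simp)
  · intro h x hx
    have : x = 0 := by simpa [Finsupp.degree_eq_zero_iff] using hx
    rw [this, h]

/-- The linear part of a polynomial. -/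
noncomputable def linearPart : MvPolynomial (Fin n) K →ₗ[K] (Fin n → K) :=
  LinearMap.pi fun i => MvPolynomial.lcoeff K (Finsupp.single i 1)

theorem mem_idealOfVars_sq_iff {a : MvPolynomial (Fin n) K} (ha : a ∈ idealOfVars (Fin n) K) :
    a ∈ idealOfVars (Fin n) K ^ 2 ↔ linearPart a = 0 := by
  rw [mem_pow_idealOfVars_iff']
  constructor
  · intro h
    ext i
    exact h _ (by simp)
  · intro h x hx
    rcases Nat.lt_succ_iff_lt_or_eq.mp hx with h0 | h1
    · have : x = 0 := by simpa [Finsupp.degree_eq_zero_iff] using h0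
      rw [this]
      exact mem_idealOfVars_iff_constantCoeff_eq_zero.mp ha
    · obtain ⟨i, rfl⟩ := (Finsupp.sum_eq_one_iff x).mp (by simpa [Finsupp.degree_eq_sum, Finsupp.sum_fintype] using h1)
      exact congrFun h i

theorem not_dvd_of_sub_one_mem {q s : MvPolynomial (Fin n) K}
    (hq : q ∈ idealOfVars (Fin n) K) (hs : s - 1 ∈ idealOfVars (Fin n) K) : ¬ q ∣ s := by
  intro h
  rw [mem_idealOfVars_iff_constantCoeff_eq_zero] at hs
  have := mem_idealOfVars_iff_constantCoeff_eq_zero.mp (Ideal.mem_of_dvd _ h hq)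
  simp [this] at hs

theorem exists_prime_dvd_of_mem_idealOfVars {t : MvPolynomial (Fin n) K} (h0 : t ≠ 0)
    (ht : t ∈ idealOfVars (Fin n) K) : ∃ q, Prime q ∧ q ∈ idealOfVars (Fin n) K ∧ q ∣ t := by
  induction t using UniqueFactorizationMonoid.induction_on_prime with
  | h₁ => exact absurd rfl h0
  | h₂ x hx =>
    rw [mem_idealOfVars_iff_constantCoeff_eq_zero] at ht
    have := hx.map (constantCoeff (R := K) (σ := Fin n))
    simp [ht] at this
  | h₃ a p ha hp ih =>
    rw [mem_idealOfVars_iff_constantCoeff_eq_zero, map_mul, mul_eq_zero] at ht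
    rcases ht with h | h
    · exact ⟨p, hp, mem_idealOfVars_iff_constantCoeff_eq_zero.mpr h, dvd_mul_right _ _⟩
    · obtain ⟨q, hq, hqm, hqd⟩ := ih ha (mem_idealOfVars_iff_constantCoeff_eq_zero.mpr h)
      exact ⟨q, hq, hqm, hqd.mul_left _⟩

end IdealOfVars

section Retract

variable {K : Type*} [Field K] {n : ℕ}
  {g : MvPolynomial (Fin n) K →ₐ[K] MvPolynomial (Fin n) K}

theorem map_pow_idealOfVars_mem (hg : ∀ a ∈ idealOfVars (Fin n) K, g a ∈ idealOfVars (Fin n) K)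
    (k : ℕ) {a : MvPolynomial (Fin n) K} (ha : a ∈ idealOfVars (Fin n) K ^ k) :
    g a ∈ idealOfVars (Fin n) K ^ k := by
  have h : (idealOfVars (Fin n) K).map g ≤ idealOfVars (Fin n) K := Ideal.map_le_iff_le_comap.mpr hg
  have := Ideal.pow_right_mono h k
  rw [← Ideal.map_pow] at this
  exact this (Ideal.mem_map_of_mem g ha)

/-- An idempotent endomorphism which vanishes on the cotangent space vanishes on the
augmentation ideal. -/
theorem eq_zero_of_map_mem_sq (hgg : ∀ a, g (g a) = g a)
    (hg : ∀ a ∈ idealOfVars (Fin n) K, g a ∈ idealOfVars (Fin n) K ^ 2)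
    {a : MvPolynomial (Fin n) K} (ha : a ∈ idealOfVars (Fin n) K) : g a = 0 := by
  have key : ∀ k : ℕ, g a ∈ idealOfVars (Fin n) K ^ (k + 1) := by
    intro k
    induction k with
    | zero => simpa using Ideal.pow_le_self two_ne_zero (hg a ha)
    | succ k ih =>
      have h : (idealOfVars (Fin n) K).map g ≤ idealOfVars (Fin n) K ^ 2 :=
        Ideal.map_le_iff_le_comap.mpr hg
      have := Ideal.pow_right_mono h (k + 1)
      rw [← Ideal.map_pow, ← pow_mul] at this
      rw [← hgg]
      exact Ideal.pow_le_pow_right (by omega) (this (Ideal.mem_map_of_mem g ih))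
  ext x
  exact (mem_pow_idealOfVars_iff' _ _).mp (key x.degree) x (Nat.lt_succ_self _)

/-- The augmentation ideal of a retract with one-dimensional cotangent space is principal. -/
theorem exists_dvd_of_retract (hgg : ∀ a, g (g a) = g a)
    (hg : ∀ a ∈ idealOfVars (Fin n) K, g a ∈ idealOfVars (Fin n) K)
    {t : MvPolynomial (Fin n) K} (hgt : g t = t) (ht : t ∈ idealOfVars (Fin n) K)
    (ht2 : t ∉ idealOfVars (Fin n) K ^ 2)
    (hdim : ∀ a ∈ idealOfVars (Fin n) K, ∃ c : K, g a - c • t ∈ idealOfVars (Fin n) K ^ 2) :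
    ∃ p ∈ idealOfVars (Fin n) K, g p = p ∧ p ≠ 0 ∧
      ∀ a ∈ idealOfVars (Fin n) K, g a = a → ∃ b, g b = b ∧ a = p * b := by
  have ht0 : t ≠ 0 := by
    rintro rfl
    exact ht2 (zero_mem _)
  obtain ⟨q, hq, hqm, hqt⟩ := exists_prime_dvd_of_mem_idealOfVars ht0 ht
  have hle : (idealOfVars (Fin n) K).map g ≤
      Ideal.span {t} ⊔ idealOfVars (Fin n) K • (idealOfVars (Fin n) K).map g := by
    rw [Ideal.map_le_iff_le_comap]
    intro a ha
    obtain ⟨c, hc⟩ := hdim a ha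
    have h1 : g a = c • t + g (g a - c • t) := by
      rw [map_sub, map_smul, hgg, hgt]
      ring
    rw [Ideal.mem_comap, h1]
    refine Submodule.add_mem_sup ?_ ?_
    · rw [MvPolynomial.smul_eq_C_mul]
      exact Ideal.mul_mem_left _ _ (Ideal.mem_span_singleton_self t)
    · have h2 := Ideal.mem_map_of_mem g hc
      rw [pow_two, Ideal.map_mul] at h2
      exact Ideal.mul_mono_left (Ideal.map_le_iff_le_comap.mpr hg) h2
  obtain ⟨s, hs, hsle⟩ := Submodule.exists_sub_one_mem_and_smul_le_of_fg_of_le_sup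
    ((idealOfVars_fg (Fin n) K).map (g : MvPolynomial (Fin n) K →+* MvPolynomial (Fin n) K))
    le_rfl hle
  have hdvd : ∀ a ∈ idealOfVars (Fin n) K, g a = a → ∃ b, g b = b ∧ a = g q * b := by
    intro a ha hga
    have h1 : s * a ∈ Ideal.span {t} := by
      apply hsle
      exact Submodule.smul_mem_pointwise_smul a s _ (by
        have := Ideal.mem_map_of_mem g ha
        rwa [hga] at this)
    have h2 : q ∣ s * a := hqt.trans (Ideal.mem_span_singleton.mp h1)
    obtain ⟨b, rfl⟩ := (hq.dvd_or_dvd h2).resolve_left (not_dvd_of_sub_one_mem hqm hs)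
    exact ⟨g b, hgg b, by rw [← map_mul, hga]⟩
  refine ⟨g q, hg q hqm, hgg q, ?_, hdvd⟩
  intro h0
  obtain ⟨b, -, hb⟩ := hdvd t ht hgt
  exact ht0 (by rw [hb, h0, zero_mul])

/-- A retract whose augmentation ideal is generated by `p` is `K[p]`. -/
theorem range_le_adjoin_of_dvd
    {p : MvPolynomial (Fin n) K} (hp : p ∈ idealOfVars (Fin n) K) (hp0 : p ≠ 0)
    (hdvd : ∀ a ∈ idealOfVars (Fin n) K, g a = a → ∃ b, g b = b ∧ a = p * b)
    (hgg : ∀ a, g (g a) = g a) : g.range ≤ Algebra.adjoin K {p} := by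
  have hdeg : 0 < p.totalDegree := by
    rw [Nat.pos_iff_ne_zero]
    intro h
    rw [MvPolynomial.totalDegree_eq_zero_iff_eq_C] at h
    rw [h, mem_idealOfVars_iff_constantCoeff_eq_zero, constantCoeff_C] at hp
    rw [hp, map_zero] at h
    exact hp0 h
  have key : ∀ (d : ℕ) (a : MvPolynomial (Fin n) K), g a = a → a.totalDegree < d →
      a ∈ Algebra.adjoin K {p} := by
    intro d
    induction d with
    | zero => intro a _ h; omega
    | succ d ih =>
      intro a hga had
      have h1 : a - C (constantCoeff a) ∈ idealOfVars (Fin n) K := by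
        rw [mem_idealOfVars_iff_constantCoeff_eq_zero]; simp
      have hgC : ∀ c : K, g (C c) = C c := fun c => g.commutes c
      obtain ⟨b, hgb, hb⟩ := hdvd _ h1 (by rw [map_sub, hga, hgC])
      have ha : a = C (constantCoeff a) + p * b := by rw [← hb]; ring
      rw [ha]
      refine add_mem (Subalgebra.algebraMap_mem _ _)
        (mul_mem (Algebra.subset_adjoin rfl) ?_)
      by_cases hb0 : b = 0
      · rw [hb0]; exact zero_mem _
      · apply ih b hgb
        have h2 := totalDegree_mul_of_isDomain hp0 hb0
        have h3 := totalDegree_sub_C_le a (constantCoeff a)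
        rw [hb] at h3
        omega
  rintro _ ⟨a, rfl⟩
  exact key _ _ (hgg a) (Nat.lt_succ_self _)

end Retract

section Surjective

theorem RingHom.injective_of_surjective_of_isNoetherianRing {R : Type*} [CommRing R]
    [IsNoetherianRing R] (f : R →+* R) (hf : Function.Surjective f) : Function.Injective f := by
  let F : ℕ →o Ideal R := ⟨fun k => RingHom.ker (f ^ k), monotone_nat_of_le_succ fun k a ha => by
    rw [RingHom.mem_ker] at ha ⊢
    rw [pow_succ', RingHom.mul_def, RingHom.comp_apply, ha, map_zero]⟩
  obtain ⟨k, hk⟩ := monotone_stabilizes_iff_noetherian.mpr ‹IsNoetherianRing R› F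
  rw [injective_iff_map_eq_zero]
  intro a ha
  have hfk : Function.Surjective (f ^ k) := by
    rw [RingHom.coe_pow]
    exact hf.iterate k
  obtain ⟨b, rfl⟩ := hfk a
  have hb : b ∈ F (k + 1) := by
    change (f ^ (k + 1)) b = 0
    rw [pow_succ', RingHom.mul_def, RingHom.comp_apply, ha]
  rwa [← hk (k + 1) (Nat.le_succ k)] at hb

theorem bijective_of_forall_X_mem_range {K : Type*} [Field K] {n : ℕ}
    (g : MvPolynomial (Fin n) K →ₐ[K] MvPolynomial (Fin n) K) (h : ∀ i, X i ∈ g.range) :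
    Function.Bijective g := by
  have hs : Function.Surjective g := by
    rw [← AlgHom.range_eq_top, eq_top_iff, ← MvPolynomial.adjoin_range_X, Algebra.adjoin_le_iff]
    rintro _ ⟨i, rfl⟩
    exact h i
  exact ⟨g.toRingHom.injective_of_surjective_of_isNoetherianRing hs, hs⟩

end Surjective

section Subbase

variable {K : Type} [Field K] {n : ℕ}

theorem zeroEnd_apply (a : MvPolynomial (Fin n) K) : zeroEnd K n a = C (constantCoeff a) := by
  rw [zeroEnd, MvPolynomial.aeval_zero', MvPolynomial.algebraMap_eq]

theorem zeroEnd_apply_of_mem {a : MvPolynomial (Fin n) K} (ha : a ∈ idealOfVars (Fin n) K) :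
    zeroEnd K n a = 0 := by
  rw [zeroEnd_apply, mem_idealOfVars_iff_constantCoeff_eq_zero.mp ha, map_zero]

variable {e : Fin n → Fin n → (MvPolynomial (Fin n) K →ₐ[K] MvPolynomial (Fin n) K)}

theorem subbase_apply_self
    (hee : ∀ i j k l, (e i j).comp (e k l) = if j = k then e i l else zeroEnd K n) (i : Fin n)
    (a : MvPolynomial (Fin n) K) : e i i (e i i a) = e i i a := by
  rw [← AlgHom.comp_apply, hee, if_pos rfl]

theorem subbase_apply_of_ne
    (hee : ∀ i j k l, (e i j).comp (e k l) = if j = k then e i l else zeroEnd K n) {i j : Fin n}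
    (hij : i ≠ j) (a : MvPolynomial (Fin n) K) : e i i (e j j a) = C (constantCoeff a) := by
  rw [← AlgHom.comp_apply, hee, if_neg hij, zeroEnd_apply]

theorem subbase_map_mem (hn : 2 ≤ n)
    (hee : ∀ i j k l, (e i j).comp (e k l) = if j = k then e i l else zeroEnd K n) (i : Fin n)
    (a : MvPolynomial (Fin n) K) (ha : a ∈ idealOfVars (Fin n) K) :
    e i i a ∈ idealOfVars (Fin n) K := by
  have : Nontrivial (Fin n) := Fin.nontrivial_iff_two_le.mpr hn
  obtain ⟨k, hk⟩ := exists_ne i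
  rw [mem_idealOfVars_iff_constantCoeff_eq_zero] at ha ⊢
  have h1 := subbase_apply_of_ne hee hk.symm (e i i a)
  rw [subbase_apply_of_ne hee hk, ha, map_zero, map_zero] at h1
  exact (C_eq_zero.mp h1.symm)

theorem exists_cotangent_generator (hn : 2 ≤ n)
    (hne : ∀ i j, e i j ≠ zeroEnd K n)
    (hee : ∀ i j k l, (e i j).comp (e k l) = if j = k then e i l else zeroEnd K n) (i : Fin n) :
    ∃ t, e i i t = t ∧ t ∈ idealOfVars (Fin n) K ∧ t ∉ idealOfVars (Fin n) K ^ 2 ∧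
      ∀ a ∈ idealOfVars (Fin n) K, ∃ c : K, e i i a - c • t ∈ idealOfVars (Fin n) K ^ 2 := by
  have hmem := subbase_map_mem hn hee
  have hself := subbase_apply_self hee
  have hex : ∀ j, ∃ t, e j j t = t ∧ t ∈ idealOfVars (Fin n) K ∧
      t ∉ idealOfVars (Fin n) K ^ 2 := by
    intro j
    by_contra! hcon
    apply hne j j
    ext k : 1
    have hX : (X k : MvPolynomial (Fin n) K) ∈ idealOfVars (Fin n) K :=
      Ideal.subset_span ⟨k, rfl⟩
    rw [zeroEnd_apply_of_mem hX]
    exact eq_zero_of_map_mem_sq (hself j)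
      (fun a ha => hcon _ (hself j a) (hmem j a ha)) hX
  choose t htt htm ht2 using hex
  have hort : ∀ j k, e j j (t k) = if k = j then t j else 0 := by
    intro j k
    split_ifs with h
    · rw [h, htt]
    · rw [← htt k, subbase_apply_of_ne hee (Ne.symm h),
        mem_idealOfVars_iff_constantCoeff_eq_zero.mp (htm k), map_zero]
  have hsum : ∀ c : Fin n → K, ∑ k, c k • t k ∈ idealOfVars (Fin n) K := fun c =>
    sum_mem fun k _ => by
      rw [MvPolynomial.smul_eq_C_mul]
      exact Ideal.mul_mem_left _ _ (htm k)
  have hproj : ∀ (c : Fin n → K) (j : Fin n), e j j (∑ k, c k • t k) = c j • t j := by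
    intro c j
    simp [hort]
  have hli : LinearIndependent K fun k => linearPart (t k) := by
    rw [Fintype.linearIndependent_iff]
    intro c hc j
    have h1 : ∑ k, c k • t k ∈ idealOfVars (Fin n) K ^ 2 := by
      rw [mem_idealOfVars_sq_iff (hsum c), map_sum]
      simpa using hc
    have h2 := map_pow_idealOfVars_mem (hmem j) 2 h1
    rw [hproj] at h2
    by_contra hcj
    apply ht2 j
    have h3 := Ideal.mul_mem_left _ (C (c j)⁻¹) h2
    rwa [← MvPolynomial.smul_eq_C_mul, smul_smul, inv_mul_cancel₀ hcj, one_smul] at h3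
  have hspan := hli.span_eq_top_of_card_eq_finrank' (by simp)
  refine ⟨t i, htt i, htm i, ht2 i, fun a ha => ?_⟩
  have h1 : linearPart a ∈ Submodule.span K (Set.range fun k => linearPart (t k)) := by
    rw [hspan]; trivial
  obtain ⟨c, hc⟩ := (Submodule.mem_span_range_iff_exists_fun K).mp h1
  have h2 : a - ∑ k, c k • t k ∈ idealOfVars (Fin n) K ^ 2 := by
    rw [mem_idealOfVars_sq_iff (sub_mem ha (hsum c)), map_sub, map_sum, ← hc]
    simp
  have h3 := map_pow_idealOfVars_mem (hmem i) 2 h2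
  rw [map_sub, hproj] at h3
  exact ⟨c i, h3⟩

/-- The image of every diagonal member of a subbase is a polynomial algebra in one generator. -/
theorem exists_range_le_adjoin (hn : 2 ≤ n)
    (hne : ∀ i j, e i j ≠ zeroEnd K n)
    (hee : ∀ i j k l, (e i j).comp (e k l) = if j = k then e i l else zeroEnd K n) (i : Fin n) :
    ∃ p ∈ idealOfVars (Fin n) K, e i i p = p ∧ (e i i).range ≤ Algebra.adjoin K {p} := by
  obtain ⟨t, htt, htm, ht2, hdim⟩ := exists_cotangent_generator hn hne hee i
  have hself := subbase_apply_self hee i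
  have hmem := subbase_map_mem hn hee i
  obtain ⟨p, hp, hpp, hp0, hdvd⟩ := exists_dvd_of_retract hself hmem htt htm ht2 hdim
  exact ⟨p, hp, hpp, range_le_adjoin_of_dvd hp hp0 hdvd hself⟩

theorem subbase_apply_base (hn : 2 ≤ n)
    (hne : ∀ i j, e i j ≠ zeroEnd K n)
    (hee : ∀ i j k l, (e i j).comp (e k l) = if j = k then e i l else zeroEnd K n)
    {i : Fin n} {z : MvPolynomial (Fin n) K} (hz : Transcendental K z)
    (hr : (e i i).range ≤ Algebra.adjoin K {z}) : e i i z = z := by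
  have hself := subbase_apply_self hee i
  rw [Algebra.adjoin_singleton_eq_range_aeval] at hr
  obtain ⟨Q, hQ⟩ := hr ⟨z, rfl⟩
  change Polynomial.aeval z Q = e i i z at hQ
  have h1 : Polynomial.aeval z ((Q - Polynomial.X).comp Q) = 0 := by
    rw [Polynomial.aeval_comp, map_sub, Polynomial.aeval_X, hQ, Polynomial.aeval_algHom_apply, hQ,
      hself, sub_self]
  have h2 := (transcendental_iff.mp hz) _ h1
  rw [Polynomial.comp_eq_zero_iff] at h2
  rcases h2 with h2 | ⟨-, h2⟩
  · rw [← hQ, sub_eq_zero.mp h2, Polynomial.aeval_X]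
  · exfalso
    apply hne i i
    rw [h2, Polynomial.aeval_C] at hQ
    have hconst : ∀ a, ∃ c, e i i a = C c := by
      intro a
      obtain ⟨P, hP⟩ := hr ⟨a, rfl⟩
      change Polynomial.aeval z P = e i i a at hP
      refine ⟨Polynomial.aeval (Q.coeff 0) P, ?_⟩
      rw [← hself, ← hP, ← Polynomial.aeval_algHom_apply, ← hQ, Polynomial.aeval_algebraMap_apply]
      rfl
    ext k : 1
    have hX : (X k : MvPolynomial (Fin n) K) ∈ idealOfVars (Fin n) K :=
      Ideal.subset_span ⟨k, rfl⟩
    rw [zeroEnd_apply_of_mem hX]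
    obtain ⟨c, hc⟩ := hconst (X k)
    have h3 := mem_idealOfVars_iff_constantCoeff_eq_zero.mp (subbase_map_mem hn hee i _ hX)
    rw [hc, constantCoeff_C] at h3
    rw [hc, h3, map_zero]

theorem internal_of_external (hn : 2 ≤ n)
    (hne : ∀ i j, e i j ≠ zeroEnd K n)
    (hee : ∀ i j k l, (e i j).comp (e k l) = if j = k then e i l else zeroEnd K n)
    {z : Fin n → MvPolynomial (Fin n) K} (hz : Function.Bijective ⇑(MvPolynomial.aeval (R := K) z))
    (hr : ∀ i, (e i i).range ≤ Algebra.adjoin K {z i})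
    (α : Fin n → (MvPolynomial (Fin n) K →ₐ[K] MvPolynomial (Fin n) K))
    {f : Fin n → Fin n → (MvPolynomial (Fin n) K →ₐ[K] MvPolynomial (Fin n) K)}
    (hfne : ∀ i j, f i j ≠ zeroEnd K n)
    (hff : ∀ i j k l, (f i j).comp (f k l) = if j = k then f i l else zeroEnd K n) :
    ∃ φ ψ : MvPolynomial (Fin n) K →ₐ[K] MvPolynomial (Fin n) K,
      ∀ i, (α i).comp (f i i) = (ψ.comp (e i i)).comp φ := by
  have hez : ∀ i, e i i (z i) = z i := fun i =>
    subbase_apply_base hn hne hee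
      ((show AlgebraicIndependent K z from hz.1).transcendental i) (hr i)
  choose t htm htt htr using exists_range_le_adjoin hn hfne hff
  have hF : ∀ i k, ∃ F : Polynomial K, Polynomial.aeval (t i) F = f i i (X k) ∧
      F.coeff 0 = 0 := by
    intro i k
    have h1 := htr i ⟨X k, rfl⟩
    rw [Algebra.adjoin_singleton_eq_range_aeval] at h1
    obtain ⟨F, hF⟩ := h1
    change Polynomial.aeval (t i) F = f i i (X k) at hF
    refine ⟨F, hF, ?_⟩
    have h2 := mem_idealOfVars_iff_constantCoeff_eq_zero.mp
      (subbase_map_mem hn hff i _ (Ideal.subset_span ⟨k, rfl⟩))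
    have h3 := mem_idealOfVars_iff_constantCoeff_eq_zero.mp (htm i)
    rw [← hF, Polynomial.aeval_def, Polynomial.hom_eval₂, h3, Polynomial.eval₂_at_zero] at h2
    simpa [MvPolynomial.algebraMap_eq] using h2
  choose F hF hF0 using hF
  let c : Fin n → K := fun i => constantCoeff (z i)
  have hort : ∀ i j, e i i (z j - C (c j)) = if j = i then z i - C (c i) else 0 := by
    intro i j
    have hC : e i i (C (c j)) = C (c j) := (e i i).commutes _
    rw [map_sub, hC]
    split_ifs with h
    · rw [h, hez]
    · rw [← hez j, subbase_apply_of_ne hee (Ne.symm h), sub_self]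
  let Z := AlgEquiv.ofBijective (MvPolynomial.aeval (R := K) z) hz
  have hZ : ∀ i, Z.symm (z i) = X i := by
    intro i
    rw [AlgEquiv.symm_apply_eq]
    simp [Z]
  refine ⟨MvPolynomial.aeval fun k => ∑ j, Polynomial.aeval (z j - C (c j)) (F j k),
    (MvPolynomial.aeval fun i => α i (t i) + C (c i)).comp Z.symm.toAlgHom, fun i => ?_⟩
  ext k : 1
  simp only [AlgHom.comp_apply, MvPolynomial.aeval_X, map_sum]
  rw [Finset.sum_eq_single i]
  · rw [← hF, ← Polynomial.aeval_algHom_apply, ← Polynomial.aeval_algHom_apply,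
      ← Polynomial.aeval_algHom_apply, ← Polynomial.aeval_algHom_apply, hort, if_pos rfl]
    congr 2
    have hC : Z.symm (C (c i)) = C (c i) := Z.symm.commutes _
    simp [hZ, hC, MvPolynomial.algebraMap_eq]
  · intro j _ hj
    rw [← Polynomial.aeval_algHom_apply, hort, if_neg hj, ← Polynomial.coeff_zero_eq_aeval_zero',
      hF0]
    simp
  · simp

/-- The endomorphism sending `x_j` to `x_i` and all other variables to `0`. -/
noncomputable def stdEnd (K : Type) [Field K] (n : ℕ) (i j : Fin n) :
    MvPolynomial (Fin n) K →ₐ[K] MvPolynomial (Fin n) K :=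
  MvPolynomial.aeval fun l => if l = j then X i else 0

theorem stdEnd_ne_zeroEnd (i j : Fin n) : stdEnd K n i j ≠ zeroEnd K n := by
  intro h
  have := DFunLike.congr_fun h (X j)
  simp [stdEnd, zeroEnd] at this

theorem stdEnd_comp (i j k l : Fin n) : (stdEnd K n i j).comp (stdEnd K n k l) =
    if j = k then stdEnd K n i l else zeroEnd K n := by
  ext m : 1
  by_cases hm : m = l <;> by_cases hjk : j = k
  all_goals simp [stdEnd, zeroEnd, hm, hjk, eq_comm (a := k)]

theorem external_of_internal (hn : 2 ≤ n)
    (hne : ∀ i j, e i j ≠ zeroEnd K n)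
    (hee : ∀ i j k l, (e i j).comp (e k l) = if j = k then e i l else zeroEnd K n)
    {φ ψ : MvPolynomial (Fin n) K →ₐ[K] MvPolynomial (Fin n) K}
    (h : ∀ i, stdEnd K n i i = (ψ.comp (e i i)).comp φ) :
    ∃ z : Fin n → MvPolynomial (Fin n) K,
      Function.Bijective ⇑(MvPolynomial.aeval (R := K) z) ∧
      ∀ i, (e i i).range ≤ Algebra.adjoin K {z i} := by
  choose p hp hpp hr using exists_range_le_adjoin hn hne hee
  have hX : ∀ i, ψ (e i i (φ (X i))) = X i := by
    intro i
    have := DFunLike.congr_fun (h i) (X i)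
    simpa [stdEnd] using this.symm
  have hψ : Function.Bijective ψ := bijective_of_forall_X_mem_range ψ fun i => ⟨_, hX i⟩
  have hψp : Function.Bijective (ψ.comp (MvPolynomial.aeval (R := K) p)) := by
    refine bijective_of_forall_X_mem_range _ fun i => ?_
    have h1 : Algebra.adjoin K {p i} ≤ (MvPolynomial.aeval (R := K) p).range :=
      Algebra.adjoin_le (by simpa using ⟨X i, MvPolynomial.aeval_X _ i⟩)
    obtain ⟨b, hb⟩ := h1 (hr i ⟨φ (X i), rfl⟩)
    refine ⟨b, ?_⟩
    change ψ (MvPolynomial.aeval p b) = X i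
    rw [← hX i]
    exact congrArg ψ hb
  exact ⟨p, (Function.Bijective.of_comp_iff' hψ _).mp hψp, hr⟩

end Subbase

/-- The 'external' and 'internal' definitions of a base collection of endomorphisms of
`K[x₁,…,xₙ]` are equivalent for every subbase `e'_{ij}` of `End K[x₁,…,xₙ]`. -/
theorem stmt_12 (K : Type) [Field K] (n : ℕ) (hn : 2 ≤ n)
    (e : Fin n → Fin n → (MvPolynomial (Fin n) K →ₐ[K] MvPolynomial (Fin n) K))
    (hne : ∀ i j, e i j ≠ zeroEnd K n)
    (hee : ∀ i j k l, (e i j).comp (e k l) = if j = k then e i l else zeroEnd K n) :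
    (∃ z : Fin n → MvPolynomial (Fin n) K,
        Function.Bijective ⇑(MvPolynomial.aeval (R := K) z) ∧
        ∀ i, (e i i).range ≤ Algebra.adjoin K {z i}) ↔
    (∀ (α : Fin n → (MvPolynomial (Fin n) K →ₐ[K] MvPolynomial (Fin n) K))
       (f : Fin n → Fin n → (MvPolynomial (Fin n) K →ₐ[K] MvPolynomial (Fin n) K)),
       (∀ i j, f i j ≠ zeroEnd K n) →
       (∀ i j k l, (f i j).comp (f k l) = if j = k then f i l else zeroEnd K n) →
       ∃ φ ψ : MvPolynomial (Fin n) K →ₐ[K] MvPolynomial (Fin n) K,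
         ∀ i, (α i).comp (f i i) = (ψ.comp (e i i)).comp φ) := by
  constructor
  · rintro ⟨z, hz, hr⟩ α f hfne hff
    exact internal_of_external hn hne hee hz hr α hfne hff
  · intro h
    obtain ⟨φ, ψ, h⟩ := h (fun _ => AlgHom.id K _) (stdEnd K n) stdEnd_ne_zeroEnd stdEnd_comp
    exact external_of_internal hn hne hee fun i => by rw [← h i, AlgHom.id_comp]
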